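/- arXiv:2210.11462 — 2 statements merged into one kernel-verified Lean document; each statement's English description precedes it below -/
import Mathlib

section
/- Let p̄ = (p_{ij}) be any joint probability distribution on ℕ×ℕ, let ε ∈ (0,1], and let q̄ = (q_{ij}) be any joint probability distribution on ℕ×ℕ with TV(p̄,q̄) ≤ ε. Then I(X₁:X₂)_q̄ ≥ Ĩ(X₁:X₂)_{[p̄−ε]₊} − 2g(ε) − h̃₂(ε) − h₂(1 − r_ε), where r_ε = ∑_{ij} max(p_{ij}−ε, 0). -/
open scoped ENNReal
open Classical

/-- The Kullback–Leibler divergence on `ℕ×ℕ`: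
`D(p̄‖q̄) = ∑_{ij} p_{ij}·ln(p_{ij}/q_{ij}) ∈ [0,+∞]`, with the conventions
`0·ln 0 = 0` and value `+∞` if `supp p̄ ⊄ supp q̄` (and `+∞` if the series
diverges). -/
noncomputable def klDiv2 (p q : ℕ × ℕ → ℝ) : ℝ≥0∞ :=
  if (∀ x, q x = 0 → p x = 0) ∧ Summable (fun x => p x * Real.log (p x / q x)) then
    ENNReal.ofReal (∑' x, p x * Real.log (p x / q x))
  else ∞

/-- The mutual information `I(X₁:X₂)_p̄ = D(p̄ ‖ p̄₁×p̄₂) ∈ [0,+∞]`, where `p̄₁, p̄₂`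
are the marginals of `p̄`. -/
noncomputable def mutInfo (p : ℕ × ℕ → ℝ) : ℝ≥0∞ :=
  klDiv2 p (fun x => (∑' j : ℕ, p (x.1, j)) * (∑' i : ℕ, p (i, x.2)))

/-- The homogeneous extension `Ĩ(X₁:X₂)_ā = ‖ā‖₁·I(X₁:X₂)_{ā/‖ā‖₁}`
(equal to `0` at `ā = 0`). -/
noncomputable def mutInfoExt (a : ℕ × ℕ → ℝ) : ℝ≥0∞ :=
  ENNReal.ofReal (∑' x, a x) * mutInfo (fun x => a x / ∑' y, a y)

/-- The binary entropy `h₂(x) = η(x) + η(1−x)`, where `η(x) = −x·ln x`. -/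
noncomputable def binEnt (x : ℝ) : ℝ := Real.negMulLog x + Real.negMulLog (1 - x)

/-- `h̃₂(x) = h₂(x)` for `x ∈ [0,1/2]` and `ln 2` for `x ∈ (1/2,1]`. -/
noncomputable def binEntTil (x : ℝ) : ℝ := if x ≤ 1 / 2 then binEnt x else Real.log 2

/-- `g(x) = (x+1)·ln(x+1) − x·ln x`. -/
noncomputable def gFun (x : ℝ) : ℝ := (x + 1) * Real.log (x + 1) - x * Real.log x

theorem summable_mul_div_rowSum {a : ℕ × ℕ → ℝ} (ha0 : ∀ x, 0 ≤ a x) (has : Summable a)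
    {u : ℕ → ℝ} (hu0 : ∀ i, 0 ≤ u i) (hus : Summable u) :
    Summable (fun x : ℕ × ℕ => a x * (u x.1 / ∑' j, a (x.1, j))) ∧
      ∑' x : ℕ × ℕ, a x * (u x.1 / ∑' j, a (x.1, j)) ≤ ∑' i, u i := by
  have hrow : ∀ i, Summable (fun j => a (i, j)) := fun i => has.prod_factor i
  have hrow0 : ∀ i, 0 ≤ ∑' j, a (i, j) := fun i => tsum_nonneg fun j => ha0 _
  have hle : ∀ i, ∑' j, a (i, j) * (u i / ∑' k, a (i, k)) ≤ u i := by
    intro i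
    rw [tsum_mul_right]
    rcases (hrow0 i).eq_or_lt with h | h
    · rw [← h]; simpa using hu0 i
    · rw [mul_div_cancel₀ _ h.ne']
  have hnn : ∀ x : ℕ × ℕ, 0 ≤ a x * (u x.1 / ∑' j, a (x.1, j)) := fun x =>
    mul_nonneg (ha0 x) (div_nonneg (hu0 _) (hrow0 _))
  have hs1 : Summable fun i => ∑' j, a (i, j) * (u i / ∑' k, a (i, k)) :=
    Summable.of_nonneg_of_le (fun i => tsum_nonneg fun j => hnn (i, j)) hle hus
  have hs : Summable (fun x : ℕ × ℕ => a x * (u x.1 / ∑' j, a (x.1, j))) := by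
    rw [summable_prod_of_nonneg fun x => hnn x]
    exact ⟨fun i => (hrow i).mul_right (u i / ∑' k, a (i, k)), hs1⟩
  refine ⟨hs, ?_⟩
  rw [hs.tsum_prod]
  exact hs1.tsum_le_tsum hle hus

theorem summable_mul_div_colSum {a : ℕ × ℕ → ℝ} (ha0 : ∀ x, 0 ≤ a x) (has : Summable a)
    {u : ℕ → ℝ} (hu0 : ∀ i, 0 ≤ u i) (hus : Summable u) :
    Summable (fun x : ℕ × ℕ => a x * (u x.2 / ∑' i, a (i, x.2))) ∧
      ∑' x : ℕ × ℕ, a x * (u x.2 / ∑' i, a (i, x.2)) ≤ ∑' j, u j := by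
  have h := summable_mul_div_rowSum (a := fun x => a x.swap) (fun x => ha0 _)
    ((Equiv.prodComm ℕ ℕ).summable_iff.2 has) hu0 hus
  refine ⟨(Equiv.prodComm ℕ ℕ).summable_iff.1 h.1, ?_⟩
  rw [← (Equiv.prodComm ℕ ℕ).tsum_eq]
  exact h.2

theorem hasSum_marginals_mul {a : ℕ × ℕ → ℝ} (ha0 : ∀ x, 0 ≤ a x) (has : Summable a) :
    HasSum (fun x : ℕ × ℕ => (∑' j, a (x.1, j)) * ∑' i, a (i, x.2))
      ((∑' x, a x) * ∑' x, a x) := by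
  have h1 : HasSum (fun i => ∑' j, a (i, j)) (∑' x, a x) :=
    has.hasSum.prod_fiberwise fun i => (has.prod_factor i).hasSum
  have has' : Summable fun x : ℕ × ℕ => a x.swap := (Equiv.prodComm ℕ ℕ).summable_iff.2 has
  have h2 : HasSum (fun j => ∑' i, a (i, j)) (∑' x, a x) := by
    have := has'.hasSum.prod_fiberwise fun j => (has'.prod_factor j).hasSum
    rwa [show ∑' x : ℕ × ℕ, a x.swap = ∑' x, a x from (Equiv.prodComm ℕ ℕ).tsum_eq a] at this
  exact h1.mul h2 (h1.summable.mul_of_nonneg h2.summable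
    (fun i => tsum_nonneg fun j => ha0 _) (fun j => tsum_nonneg fun i => ha0 _))

theorem sub_le_mul_log_div {a c : ℝ} (ha : 0 < a) (hc : 0 < c) :
    a - c ≤ a * Real.log (a / c) := by
  have h := Real.one_sub_inv_le_log_of_pos (div_pos ha hc)
  have h' := mul_le_mul_of_nonneg_left h ha.le
  rwa [inv_div, mul_sub, mul_one, mul_div_cancel₀ _ ha.ne'] at h'

/-- The pointwise comparison behind `I(X₁:X₂)_q ≥ Ĩ(X₁:X₂)_a - h₂(1 - ‖a‖₁)` for `a ≤ q`. -/
theorem mul_log_mutInfo_le {a q r a₁ a₂ q₁ q₂ : ℝ} (ha : 0 ≤ a) (haq : a ≤ q)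
    (hr : 0 < r) (hs : q - a ≤ 1 - r) (ha₁ : a ≤ a₁) (ha₂ : a ≤ a₂)
    (hq₁ : q ≤ q₁) (hq₂ : q ≤ q₂) :
    a * Real.log (a * r / (a₁ * a₂)) ≤ q * Real.log (q / (q₁ * q₂))
      + r * (a * (q₁ / a₁)) + r * (a * (q₂ / a₂)) + (1 - r) * (q₁ * q₂)
      - (a + q) - a * Real.log r - (q - a) * Real.log (1 - r) := by
  have hb : (q - a) - (1 - r) * (q₁ * q₂) + (q - a) * Real.log (1 - r)
      ≤ (q - a) * Real.log (q / (q₁ * q₂)) := by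
    rcases haq.eq_or_lt with h | h
    · subst h
      have h3 : 0 ≤ (1 - r) * (q₁ * q₂) :=
        mul_nonneg (by linarith) (mul_nonneg (ha.trans hq₁) (ha.trans hq₂))
      simp only [sub_self, zero_mul]
      linarith
    · have hb : 0 < q - a := sub_pos.2 h
      have hs0 : 0 < 1 - r := hb.trans_le hs
      have hq : 0 < q := ha.trans_lt h
      have hqq : 0 < q₁ * q₂ := mul_pos (hq.trans_le hq₁) (hq.trans_le hq₂)
      have h1 := sub_le_mul_log_div hb (mul_pos hs0 hqq)
      have h2 : Real.log ((q - a) / ((1 - r) * (q₁ * q₂))) + Real.log (1 - r)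
          ≤ Real.log (q / (q₁ * q₂)) := by
        rw [← Real.log_mul (by positivity) hs0.ne']
        apply Real.log_le_log (by positivity)
        rw [div_mul_eq_mul_div, mul_comm (1 - r), mul_div_mul_right _ _ hs0.ne']
        gcongr
        linarith
      nlinarith [mul_le_mul_of_nonneg_left h2 hb.le]
  have hA : a * Real.log (a * r / (a₁ * a₂)) ≤ a * Real.log (q / (q₁ * q₂))
      + r * (a * (q₁ / a₁)) + r * (a * (q₂ / a₂)) - 2 * a - a * Real.log r := by
    rcases ha.eq_or_lt with h | h
    · simp [← h]
    · have hq : 0 < q := h.trans_le haq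
      have ha₁' := h.trans_le ha₁
      have ha₂' := h.trans_le ha₂
      have hq₁' := hq.trans_le hq₁
      have hq₂' := hq.trans_le hq₂
      have e : Real.log (a * r / (a₁ * a₂)) = Real.log (q / (q₁ * q₂))
          + Real.log (r * (q₁ / a₁)) + Real.log (r * (q₂ / a₂)) + Real.log (a / q)
          - Real.log r := by
        rw [← Real.log_mul, ← Real.log_mul, ← Real.log_mul, ← Real.log_div]
        · congr 1
          field_simp
        all_goals positivity
      have h1 := Real.log_le_sub_one_of_pos (show 0 < r * (q₁ / a₁) by positivity)
      have h2 := Real.log_le_sub_one_of_pos (show 0 < r * (q₂ / a₂) by positivity)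
      have h3 : Real.log (a / q) ≤ 0 :=
        Real.log_nonpos (by positivity) ((div_le_one hq).2 haq)
      have := mul_le_mul_of_nonneg_left (show Real.log (a * r / (a₁ * a₂)) ≤
        Real.log (q / (q₁ * q₂)) + (r * (q₁ / a₁) - 1) + (r * (q₂ / a₂) - 1) - Real.log r by
          linarith) ha
      linarith
  linarith

/-- If `0 ≤ a ≤ q` and `q` is a probability distribution, then
`Ĩ(X₁:X₂)_a ≤ I(X₁:X₂)_q + h₂(1 - ‖a‖₁)`. -/
theorem mutInfoExt_le_mutInfo_add_binEnt {a q : ℕ × ℕ → ℝ} (ha0 : ∀ x, 0 ≤ a x)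
    (haq : ∀ x, a x ≤ q x) (hqs : Summable q) (hq1 : ∑' x, q x = 1) :
    mutInfoExt a ≤ mutInfo q + ENNReal.ofReal (binEnt (1 - ∑' x, a x)) := by
  have hq0 : ∀ x, 0 ≤ q x := fun x => (ha0 x).trans (haq x)
  have has : Summable a := Summable.of_nonneg_of_le ha0 haq hqs
  set r := ∑' x, a x with hr_def
  rcases (tsum_nonneg ha0 : 0 ≤ ∑' x, a x).eq_or_lt with hr | hr
  · simp [mutInfoExt, ← hr]
  rw [← hr_def] at hr
  by_cases hfin : mutInfo q = ∞
  · simp [hfin]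
  set a₁ : ℕ → ℝ := fun i => ∑' j, a (i, j)
  set a₂ : ℕ → ℝ := fun j => ∑' i, a (i, j)
  set q₁ : ℕ → ℝ := fun i => ∑' j, q (i, j)
  set q₂ : ℕ → ℝ := fun j => ∑' i, q (i, j)
  have row_le : ∀ {f : ℕ × ℕ → ℝ}, (∀ x, 0 ≤ f x) → Summable f →
      ∀ x : ℕ × ℕ, f x ≤ ∑' j, f (x.1, j) := fun hf0 hf x =>
    (hf.prod_factor x.1).le_tsum x.2 fun j _ => hf0 _
  have col_le : ∀ {f : ℕ × ℕ → ℝ}, (∀ x, 0 ≤ f x) → Summable f →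
      ∀ x : ℕ × ℕ, f x ≤ ∑' i, f (i, x.2) := fun hf0 hf x =>
    row_le (f := fun y => _) (fun y => hf0 y.swap)
      ((Equiv.prodComm ℕ ℕ).summable_iff.2 hf) x.swap
  have hab : ∀ x, q x - a x ≤ 1 - r := fun x => by
    rw [← hq1, hr_def, ← hqs.tsum_sub has]
    exact (hqs.sub has).le_tsum x fun y _ => sub_nonneg.2 (haq y)
  obtain ⟨hac, hI⟩ : (∀ x : ℕ × ℕ, q₁ x.1 * q₂ x.2 = 0 → q x = 0) ∧
      Summable (fun x : ℕ × ℕ => q x * Real.log (q x / (q₁ x.1 * q₂ x.2))) := by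
    by_contra h
    exact hfin (if_neg h)
  have hIq : mutInfo q =
      ENNReal.ofReal (∑' x : ℕ × ℕ, q x * Real.log (q x / (q₁ x.1 * q₂ x.2))) :=
    if_pos ⟨hac, hI⟩
  have hqq := hasSum_marginals_mul hq0 hqs
  have haa := hasSum_marginals_mul ha0 has
  rw [hq1, mul_one] at hqq
  have hq₁s : HasSum q₁ 1 := hq1 ▸ hqs.hasSum.prod_fiberwise fun i => (hqs.prod_factor i).hasSum
  have hq₂s : HasSum q₂ 1 := by
    have hqs' : Summable fun x : ℕ × ℕ => q x.swap := (Equiv.prodComm ℕ ℕ).summable_iff.2 hqs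
    have := hqs'.hasSum.prod_fiberwise fun j => (hqs'.prod_factor j).hasSum
    rwa [show ∑' x : ℕ × ℕ, q x.swap = ∑' x, q x from (Equiv.prodComm ℕ ℕ).tsum_eq q,
      hq1] at this
  obtain ⟨hw₁, hw₁'⟩ := summable_mul_div_rowSum ha0 has
    (fun i => tsum_nonneg fun j => hq0 (i, j)) hq₁s.summable
  obtain ⟨hw₂, hw₂'⟩ := summable_mul_div_colSum ha0 has
    (fun j => tsum_nonneg fun i => hq0 (i, j)) hq₂s.summable
  rw [hq₁s.tsum_eq] at hw₁'
  rw [hq₂s.tsum_eq] at hw₂'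
  have hU := ((((((hI.hasSum.add (hw₁.hasSum.mul_left r)).add (hw₂.hasSum.mul_left r)).add
    (hqq.mul_left (1 - r))).sub (has.hasSum.add hqs.hasSum)).sub
    (has.hasSum.mul_right (Real.log r))).sub
    ((hqs.hasSum.sub has.hasSum).mul_right (Real.log (1 - r))))
  have hle : ∀ x : ℕ × ℕ, _ ≤ _ := fun x => mul_log_mutInfo_le (ha0 x) (haq x) hr (hab x)
    (row_le ha0 has x) (col_le ha0 has x) (row_le hq0 hqs x) (col_le hq0 hqs x)
  have hL := has.hasSum.sub (haa.div_const r)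
  have hge : ∀ x : ℕ × ℕ, a x - a₁ x.1 * a₂ x.2 / r
      ≤ a x * Real.log (a x * r / (a₁ x.1 * a₂ x.2)) := fun x => by
    have h₁ : a x ≤ a₁ x.1 := row_le ha0 has x
    have h₂ : a x ≤ a₂ x.2 := col_le ha0 has x
    rcases (ha0 x).eq_or_lt with h | h
    · rw [← h] at h₁ h₂ ⊢
      have : 0 ≤ a₁ x.1 * a₂ x.2 / r := by positivity
      simpa using this
    · have h₁' := h.trans_le h₁
      have h₂' := h.trans_le h₂
      have := sub_le_mul_log_div h (show 0 < a₁ x.1 * a₂ x.2 / r by positivity)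
      rwa [div_div_eq_mul_div] at this
  have hA : Summable (fun x : ℕ × ℕ => a x * Real.log (a x * r / (a₁ x.1 * a₂ x.2))) := by
    have := Summable.of_nonneg_of_le (fun x => sub_nonneg.2 (hge x))
      (fun x => sub_le_sub_right (hle x) _) (hU.summable.sub hL.summable)
    exact (this.add hL.summable).congr fun x => sub_add_cancel _ _
  have hterm : ∀ x : ℕ × ℕ, a x / r *
      Real.log (a x / r / ((∑' j, a (x.1, j) / r) * ∑' i, a (i, x.2) / r))
        = a x * Real.log (a x * r / (a₁ x.1 * a₂ x.2)) / r := fun x => by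
    rw [tsum_div_const, tsum_div_const, div_mul_div_comm, div_div_div_eq, div_mul_eq_mul_div,
      ← mul_assoc, mul_comm r (_ * _), mul_div_mul_right _ _ hr.ne']
  have hIa : mutInfoExt a =
      ENNReal.ofReal (∑' x : ℕ × ℕ, a x * Real.log (a x * r / (a₁ x.1 * a₂ x.2))) := by
    rw [mutInfoExt, mutInfo, klDiv2, if_pos, ← ENNReal.ofReal_mul (tsum_nonneg ha0)]
    · simp only [← hr_def, hterm]
      rw [tsum_div_const, mul_div_cancel₀ _ hr.ne']
    · simp only [← hr_def, hterm]
      refine ⟨fun x hx => ?_, hA.div_const r⟩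
      have h₁ := row_le ha0 has x
      have h₂ := col_le ha0 has x
      rw [tsum_div_const, tsum_div_const] at hx
      have : a x = 0 := by
        rcases mul_eq_zero.1 hx with h | h <;>
          rcases div_eq_zero_iff.1 h with h | h <;>
          first
            | exact absurd h hr.ne'
            | exact le_antisymm (by linarith) (ha0 x)
      simp [this]
  have hfinal := hA.tsum_le_tsum hle hU.summable
  rw [hU.tsum_eq, hq1, ← hr_def] at hfinal
  rw [hIa, hIq]
  refine (ENNReal.ofReal_le_ofReal ?_).trans ENNReal.ofReal_add_le
  have hm₁ := mul_le_mul_of_nonneg_left hw₁' hr.le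
  have hm₂ := mul_le_mul_of_nonneg_left hw₂' hr.le
  simp only [binEnt, Real.negMulLog, sub_sub_cancel]
  linarith

theorem sub_le_of_half_tsum_abs_sub_le {p q : ℕ × ℕ → ℝ} (hps : Summable p) (hqs : Summable q)
    (hpq : ∑' x, p x = ∑' x, q x) {ε : ℝ} (hTV : (1 / 2) * ∑' x, |p x - q x| ≤ ε)
    (x : ℕ × ℕ) : p x - q x ≤ ε := by
  have hd := hps.sub hqs
  have h := (hd.abs.add hd).le_tsum x fun y _ => by linarith [neg_abs_le (p y - q y)]
  rw [hd.abs.tsum_add hd, hps.tsum_sub hqs, hpq] at h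
  linarith [le_abs_self (p x - q x)]

/-- for joint probability distributions `p̄, q̄` on `ℕ×ℕ` with
`TV(p̄,q̄) ≤ ε`, `ε ∈ (0,1]`, one has
`I(X₁:X₂)_q̄ ≥ Ĩ(X₁:X₂)_{[p̄−ε]₊} − 2g(ε) − h̃₂(ε) − h₂(1−r_ε)` with
`r_ε = ∑_{ij} max(p_{ij}−ε,0)`, stated in `[0,+∞]` as
`Ĩ(X₁:X₂)_{[p̄−ε]₊} ≤ I(X₁:X₂)_q̄ + 2g(ε) + h̃₂(ε) + h₂(1−r_ε)`. -/
theorem mutInfo_local_lower_bound (p q : ℕ × ℕ → ℝ)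
    (hp0 : ∀ x, 0 ≤ p x) (hps : Summable p) (hp1 : ∑' x, p x = 1)
    (hq0 : ∀ x, 0 ≤ q x) (hqs : Summable q) (hq1 : ∑' x, q x = 1)
    (ε : ℝ) (hε : ε ∈ Set.Ioc (0 : ℝ) 1)
    (hTV : (1 / 2) * ∑' x, |p x - q x| ≤ ε) :
    mutInfoExt (fun x => max (p x - ε) 0)
      ≤ mutInfo q
        + ENNReal.ofReal (2 * gFun ε)
        + ENNReal.ofReal (binEntTil ε)
        + ENNReal.ofReal (binEnt (1 - ∑' x, max (p x - ε) 0)) := by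
  have haq : ∀ x, max (p x - ε) 0 ≤ q x := fun x => max_le
    (by linarith [sub_le_of_half_tsum_abs_sub_le hps hqs (hp1.trans hq1.symm) hTV x]) (hq0 x)
  refine (mutInfoExt_le_mutInfo_add_binEnt (fun x => le_max_right _ _) haq hqs hq1).trans ?_
  gcongr
  rw [add_assoc]
  exact le_self_add
end

section
/- Let p̄ = (p_{ij}) be a joint probability distribution on ℕ×ℕ with I(X₁:X₂)_p̄ < +∞, let ε ∈ (0,1], and let q̄ = (q_{ij}) be any joint probability distribution on ℕ×ℕ with TV(p̄,q̄) ≤ ε. Then I(X₁:X₂)_q̄ ≥ I(X₁:X₂)_p̄ − Ĩ(X₁:X₂)_{p̄∧ε} − 2g(ε) − h̃₂(ε). -/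
open scoped ENNReal
open Classical

namespace MutInfoBound

/-- The first marginal of a family. -/
noncomputable def row (a : ℕ × ℕ → ℝ) (i : ℕ) : ℝ := ∑' j, a (i, j)

/-- The second marginal of a family. -/
noncomputable def col (a : ℕ × ℕ → ℝ) (j : ℕ) : ℝ := ∑' i, a (i, j)

/-- The logarithmic density of `a / ‖a‖₁` with respect to the product of its marginals. -/
noncomputable def logDensity (a : ℕ × ℕ → ℝ) (x : ℕ × ℕ) : ℝ :=
  Real.log (a x * (∑' y, a y) / (row a x.1 * col a x.2))

/-- The homogeneous mutual information as a real-valued sum. -/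
noncomputable def info (a : ℕ × ℕ → ℝ) : ℝ := ∑' x, a x * logDensity a x

/-- The entropy of splitting a mass `a + b` into `a` and `b`. -/
noncomputable def splitEnt (a b : ℝ) : ℝ :=
  a * Real.log ((a + b) / a) + b * Real.log ((a + b) / b)

lemma row_comp_swap (a : ℕ × ℕ → ℝ) : row (a ∘ Prod.swap) = col a := rfl

lemma summable_comp_swap {a : ℕ × ℕ → ℝ} (hs : Summable a) : Summable (a ∘ Prod.swap) :=
  (Equiv.prodComm ℕ ℕ).summable_iff.2 hs

lemma tsum_comp_swap (a : ℕ × ℕ → ℝ) : ∑' x : ℕ × ℕ, a x.swap = ∑' x, a x :=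
  (Equiv.prodComm ℕ ℕ).tsum_eq a

section Marginals

variable {a c : ℕ × ℕ → ℝ}

lemma row_nonneg (ha : ∀ x, 0 ≤ a x) (i : ℕ) : 0 ≤ row a i := tsum_nonneg fun _ => ha _

lemma col_nonneg (ha : ∀ x, 0 ≤ a x) (i : ℕ) : 0 ≤ col a i := tsum_nonneg fun _ => ha _

lemma le_row (ha : ∀ x, 0 ≤ a x) (hs : Summable a) (x : ℕ × ℕ) : a x ≤ row a x.1 :=
  (hs.prod_factor x.1).le_tsum x.2 fun _ _ => ha _

lemma le_col (ha : ∀ x, 0 ≤ a x) (hs : Summable a) (x : ℕ × ℕ) : a x ≤ col a x.2 :=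
  le_row (a := a ∘ Prod.swap) (fun _ => ha _) (summable_comp_swap hs) x.swap

lemma row_le_row (hac : ∀ x, a x ≤ c x) (hs : Summable a) (hc : Summable c) (i : ℕ) :
    row a i ≤ row c i :=
  (hs.prod_factor i).tsum_le_tsum (fun _ => hac _) (hc.prod_factor i)

lemma summable_row (hs : Summable a) : Summable (row a) := hs.prod

lemma tsum_row (hs : Summable a) : ∑' i, row a i = ∑' x, a x := hs.tsum_prod.symm

lemma summable_col (hs : Summable a) : Summable (col a) :=
  summable_row (summable_comp_swap hs)

lemma tsum_col (hs : Summable a) : ∑' i, col a i = ∑' x, a x :=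
  (tsum_row (summable_comp_swap hs)).trans (tsum_comp_swap a)

lemma summable_mul_row {φ : ℕ → ℝ} (hφ : ∀ i, 0 ≤ φ i) (ha : ∀ x, 0 ≤ a x) (hs : Summable a)
    (h : Summable fun i => φ i * row a i) : Summable fun x : ℕ × ℕ => φ x.1 * a x := by
  refine (summable_prod_of_nonneg (f := fun x : ℕ × ℕ => φ x.1 * a x)
    fun x => mul_nonneg (hφ _) (ha _)).2 ⟨fun i => (hs.prod_factor i).mul_left (φ i), ?_⟩
  simpa only [tsum_mul_left, row] using h

lemma tsum_mul_row {φ : ℕ → ℝ} (hφ : ∀ i, 0 ≤ φ i) (ha : ∀ x, 0 ≤ a x) (hs : Summable a)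
    (h : Summable fun i => φ i * row a i) :
    ∑' x : ℕ × ℕ, φ x.1 * a x = ∑' i, φ i * row a i := by
  rw [(summable_mul_row hφ ha hs h).tsum_prod]
  simp only [tsum_mul_left, row]

end Marginals

section Comparison

variable {a c : ℕ × ℕ → ℝ}

lemma mul_log_row_nonneg (ha : ∀ x, 0 ≤ a x) (hac : ∀ x, a x ≤ c x) (hs : Summable a)
    (hc : Summable c) (x : ℕ × ℕ) : 0 ≤ a x * Real.log (row c x.1 / row a x.1) := by
  rcases (ha x).eq_or_lt with h | h
  · simp [← h]
  · exact mul_nonneg h.le (Real.log_nonneg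
      ((one_le_div (h.trans_le (le_row ha hs x))).2 (row_le_row hac hs hc _)))

lemma div_mul_row_le (hc : ∀ x, 0 ≤ c x) (i : ℕ) : row c i / row a i * row a i ≤ row c i := by
  by_cases h : row a i = 0
  · simpa [h] using row_nonneg hc i
  · rw [div_mul_cancel₀ _ h]

lemma div_row_mul_eq (ha : ∀ x, 0 ≤ a x) (hac : ∀ x, a x ≤ c x) (hs : Summable a)
    (hc : Summable c) (i : ℕ) : row a i / row c i * row c i = row a i :=
  div_mul_cancel_of_imp fun h =>
    le_antisymm ((row_le_row hac hs hc i).trans h.le) (row_nonneg ha i)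

lemma summable_div_row_mul (ha : ∀ x, 0 ≤ a x) (hac : ∀ x, a x ≤ c x) (hs : Summable a)
    (hc : Summable c) : Summable fun x : ℕ × ℕ => row c x.1 / row a x.1 * a x := by
  have hc0 x := (ha x).trans (hac x)
  have hφ i : 0 ≤ row c i / row a i := div_nonneg (row_nonneg hc0 i) (row_nonneg ha i)
  exact summable_mul_row hφ ha hs ((summable_row hc).of_nonneg_of_le
    (fun i => mul_nonneg (hφ i) (row_nonneg ha i)) (div_mul_row_le hc0))

lemma tsum_div_row_mul_le (ha : ∀ x, 0 ≤ a x) (hac : ∀ x, a x ≤ c x) (hs : Summable a)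
    (hc : Summable c) : ∑' x : ℕ × ℕ, row c x.1 / row a x.1 * a x ≤ ∑' x, c x := by
  have hc0 x := (ha x).trans (hac x)
  have hφ i : 0 ≤ row c i / row a i := div_nonneg (row_nonneg hc0 i) (row_nonneg ha i)
  have h : Summable fun i => row c i / row a i * row a i := (summable_row hc).of_nonneg_of_le
    (fun i => mul_nonneg (hφ i) (row_nonneg ha i)) (div_mul_row_le hc0)
  rw [tsum_mul_row hφ ha hs h, ← tsum_row hc]
  exact h.tsum_le_tsum (div_mul_row_le hc0) (summable_row hc)

lemma summable_mul_log_row (ha : ∀ x, 0 ≤ a x) (hac : ∀ x, a x ≤ c x) (hs : Summable a)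
    (hc : Summable c) : Summable fun x : ℕ × ℕ => a x * Real.log (row c x.1 / row a x.1) := by
  refine (summable_div_row_mul ha hac hs hc).of_nonneg_of_le
    (mul_log_row_nonneg ha hac hs hc) fun x => ?_
  rw [mul_comm]
  exact mul_le_mul_of_nonneg_right (Real.log_le_self (div_nonneg
    (row_nonneg (fun x => (ha x).trans (hac x)) _) (row_nonneg ha _))) (ha x)

lemma tsum_mul_log_row_le (ha : ∀ x, 0 ≤ a x) (hac : ∀ x, a x ≤ c x) (hs : Summable a)
    (hc : Summable c) : ∑' x : ℕ × ℕ, a x * Real.log (row c x.1 / row a x.1) ≤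
      (∑' x, a x) * Real.log ((∑' x, c x) / ∑' x, a x) := by
  set A := ∑' x, a x with hA
  set C := ∑' x, c x with hC
  have hAC : A ≤ C := hs.tsum_le_tsum hac hc
  have hA0 : 0 ≤ A := tsum_nonneg ha
  rcases hA0.eq_or_lt with h0 | hpos
  · have : ∀ x, a x = 0 := fun x => le_antisymm ((hs.le_tsum x fun _ _ => ha _).trans h0.ge) (ha x)
    simp [this, ← h0]
  have hCpos : 0 < C := hpos.trans_le hAC
  have hsum := ((hs.mul_right (Real.log (C / A))).add
    ((summable_div_row_mul ha hac hs hc).mul_left (A / C))).sub hs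
  have key := (summable_mul_log_row ha hac hs hc).tsum_le_tsum (fun x => ?_) hsum
  · rw [((hs.mul_right (Real.log (C / A))).add
      ((summable_div_row_mul ha hac hs hc).mul_left (A / C))).tsum_sub hs,
      (hs.mul_right (Real.log (C / A))).tsum_add
      ((summable_div_row_mul ha hac hs hc).mul_left (A / C)), tsum_mul_left, tsum_mul_right,
      ← hA] at key
    have h1 : A / C * ∑' x : ℕ × ℕ, row c x.1 / row a x.1 * a x ≤ A / C * C :=
      mul_le_mul_of_nonneg_left (tsum_div_row_mul_le ha hac hs hc) (by positivity)
    rw [div_mul_cancel₀ _ hCpos.ne'] at h1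
    linarith
  · rcases (ha x).eq_or_lt with h | h
    · simp [← h]
    have hr : 0 < row a x.1 := h.trans_le (le_row ha hs x)
    have hr' : 0 < row c x.1 := hr.trans_le (row_le_row hac hs hc _)
    have h2 := Real.log_le_sub_one_of_pos
      (show 0 < A / C * (row c x.1 / row a x.1) by positivity)
    rw [Real.log_mul (by positivity) (by positivity), ← neg_neg (Real.log (A / C)),
      ← Real.log_inv, inv_div] at h2
    have h3 := mul_le_mul_of_nonneg_left h2 h.le
    linarith

lemma mul_log_div_nonneg (ha : ∀ x, 0 ≤ a x) (hac : ∀ x, a x ≤ c x) (x : ℕ × ℕ) :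
    0 ≤ a x * Real.log (c x / a x) := by
  rcases (ha x).eq_or_lt with h | h
  · simp [← h]
  · exact mul_nonneg h.le (Real.log_nonneg ((one_le_div h).2 (hac x)))

lemma summable_mul_log_div (ha : ∀ x, 0 ≤ a x) (hac : ∀ x, a x ≤ c x) (hc : Summable c) :
    Summable fun x => a x * Real.log (c x / a x) := by
  refine hc.of_nonneg_of_le (mul_log_div_nonneg ha hac) fun x => ?_
  rcases (ha x).eq_or_lt with h | h
  · simpa [← h] using (ha x).trans (hac x)
  · calc a x * Real.log (c x / a x) ≤ a x * (c x / a x) :=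
        mul_le_mul_of_nonneg_left (Real.log_le_self (div_nonneg (h.le.trans (hac x)) h.le)) h.le
      _ = c x := mul_div_cancel₀ _ h.ne'

lemma tsum_mul_log_div_le (ha : ∀ x, 0 ≤ a x) (hac : ∀ x, a x ≤ c x) (hs : Summable a)
    (hc : Summable c) : ∑' x, a x * Real.log (c x / a x) ≤
      ∑' x : ℕ × ℕ, a x * Real.log (row c x.1 / row a x.1) := by
  have hc0 x := (ha x).trans (hac x)
  have hφ i : 0 ≤ row a i / row c i := div_nonneg (row_nonneg ha i) (row_nonneg hc0 i)
  have hR : Summable fun i => row a i / row c i * row c i := by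
    simpa only [div_row_mul_eq ha hac hs hc] using summable_row hs
  have hM := summable_mul_row hφ hc0 hc hR
  have hM' := tsum_mul_row hφ hc0 hc hR
  simp only [div_row_mul_eq ha hac hs hc, tsum_row hs] at hM'
  have hL := summable_mul_log_row ha hac hs hc
  have key := (summable_mul_log_div ha hac hc).tsum_le_tsum (fun x => ?_) ((hL.add hM).sub hs)
  · rw [(hL.add hM).tsum_sub hs, hL.tsum_add hM, hM'] at key
    linarith
  · rcases (ha x).eq_or_lt with h | h
    · simpa [← h] using mul_nonneg (hφ x.1) (hc0 x)
    have hr : 0 < row a x.1 := h.trans_le (le_row ha hs x)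
    have hr' : 0 < row c x.1 := hr.trans_le (row_le_row hac hs hc _)
    have hcx : 0 < c x := h.trans_le (hac x)
    have h2 := Real.log_le_sub_one_of_pos
      (show 0 < (c x / a x) * (row a x.1 / row c x.1) by positivity)
    rw [Real.log_mul (by positivity) (by positivity), ← neg_neg (Real.log (row a x.1 / _)),
      ← Real.log_inv, inv_div] at h2
    have h3 := mul_le_mul_of_nonneg_left h2 h.le
    have h4 : a x * (c x / a x * (row a x.1 / row c x.1) - 1) =
        row a x.1 / row c x.1 * c x - a x := by field_simp
    linarith

lemma summable_mul_log_col (ha : ∀ x, 0 ≤ a x) (hac : ∀ x, a x ≤ c x) (hs : Summable a)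
    (hc : Summable c) : Summable fun x : ℕ × ℕ => a x * Real.log (col c x.2 / col a x.2) :=
  summable_comp_swap (summable_mul_log_row (a := a ∘ Prod.swap) (c := c ∘ Prod.swap)
    (fun _ => ha _) (fun _ => hac _) (summable_comp_swap hs) (summable_comp_swap hc))

lemma tsum_mul_log_col_nonneg (ha : ∀ x, 0 ≤ a x) (hac : ∀ x, a x ≤ c x) (hs : Summable a)
    (hc : Summable c) : 0 ≤ ∑' x : ℕ × ℕ, a x * Real.log (col c x.2 / col a x.2) :=
  tsum_nonneg fun x => mul_log_row_nonneg (a := a ∘ Prod.swap) (c := c ∘ Prod.swap)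
    (fun _ => ha _) (fun _ => hac _) (summable_comp_swap hs) (summable_comp_swap hc) x.swap

lemma tsum_mul_log_col_le (ha : ∀ x, 0 ≤ a x) (hac : ∀ x, a x ≤ c x) (hs : Summable a)
    (hc : Summable c) : ∑' x : ℕ × ℕ, a x * Real.log (col c x.2 / col a x.2) ≤
      (∑' x, a x) * Real.log ((∑' x, c x) / ∑' x, a x) := by
  have h := tsum_mul_log_row_le (a := a ∘ Prod.swap) (c := c ∘ Prod.swap)
    (fun _ => ha _) (fun _ => hac _) (summable_comp_swap hs) (summable_comp_swap hc)
  simp only [row_comp_swap, Function.comp_apply, tsum_comp_swap] at h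
  rwa [← tsum_comp_swap]

lemma mul_logDensity_sub (ha : ∀ x, 0 ≤ a x) (hac : ∀ x, a x ≤ c x) (hs : Summable a)
    (hc : Summable c) (x : ℕ × ℕ) :
    a x * logDensity c x - a x * logDensity a x =
      a x * Real.log (c x / a x) + a x * Real.log ((∑' y, c y) / ∑' y, a y) -
        a x * Real.log (row c x.1 / row a x.1) - a x * Real.log (col c x.2 / col a x.2) := by
  rcases (ha x).eq_or_lt with h | h
  · simp [← h]
  have h1 : row a x.1 ≠ 0 := (h.trans_le (le_row ha hs x)).ne'
  have h2 : row c x.1 ≠ 0 := ((h.trans_le (le_row ha hs x)).trans_le (row_le_row hac hs hc _)).ne'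
  have hc0 x := (ha x).trans (hac x)
  have h3 : col a x.2 ≠ 0 := (h.trans_le (le_col ha hs x)).ne'
  have hcx : 0 < c x := h.trans_le (hac x)
  have h4 : col c x.2 ≠ 0 := (hcx.trans_le (le_col hc0 hc x)).ne'
  have h5 : ∑' y, a y ≠ 0 := (h.trans_le (hs.le_tsum x fun _ _ => ha _)).ne'
  have h6 : ∑' y, c y ≠ 0 := (hcx.trans_le (hc.le_tsum x fun _ _ => hc0 _)).ne'
  unfold logDensity
  rw [Real.log_div (mul_ne_zero hcx.ne' h6) (mul_ne_zero h2 h4),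
    Real.log_div (mul_ne_zero h.ne' h5) (mul_ne_zero h1 h3), Real.log_mul hcx.ne' h6,
    Real.log_mul h.ne' h5, Real.log_mul h2 h4, Real.log_mul h1 h3, Real.log_div hcx.ne' h.ne',
    Real.log_div h6 h5, Real.log_div h2 h1, Real.log_div h4 h3]
  ring

lemma summable_mul_logDensity_sub (ha : ∀ x, 0 ≤ a x) (hac : ∀ x, a x ≤ c x) (hs : Summable a)
    (hc : Summable c) : Summable fun x => a x * logDensity c x - a x * logDensity a x := by
  simp only [mul_logDensity_sub ha hac hs hc]
  exact (((summable_mul_log_div ha hac hc).add (hs.mul_right _)).sub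
    (summable_mul_log_row ha hac hs hc)).sub (summable_mul_log_col ha hac hs hc)

/-- Replacing the log-density of `a` by that of a dominating family costs at most the
surprisal of the mass of `a`. -/
lemma abs_tsum_mul_logDensity_sub_le (ha : ∀ x, 0 ≤ a x) (hac : ∀ x, a x ≤ c x)
    (hs : Summable a) (hc : Summable c) :
    |∑' x, (a x * logDensity c x - a x * logDensity a x)| ≤
      (∑' x, a x) * Real.log ((∑' x, c x) / ∑' x, a x) := by
  simp only [mul_logDensity_sub ha hac hs hc]
  have s1 := summable_mul_log_div ha hac hc
  have s2 := hs.mul_right (Real.log ((∑' y, c y) / ∑' y, a y))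
  have s3 := summable_mul_log_row ha hac hs hc
  have s4 := summable_mul_log_col ha hac hs hc
  rw [((s1.add s2).sub s3).tsum_sub s4, (s1.add s2).tsum_sub s3, s1.tsum_add s2, tsum_mul_right]
  have h1 : 0 ≤ ∑' x, a x * Real.log (c x / a x) := tsum_nonneg (mul_log_div_nonneg ha hac)
  have h2 := tsum_mul_log_div_le ha hac hs hc
  have h3 := tsum_mul_log_row_le ha hac hs hc
  have h4 := tsum_mul_log_col_le ha hac hs hc
  have h5 := tsum_mul_log_col_nonneg ha hac hs hc
  rw [abs_le]
  constructor <;> linarith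

lemma summable_mul_logDensity_of_le (ha : ∀ x, 0 ≤ a x) (hac : ∀ x, a x ≤ c x)
    (h : Summable fun x => c x * logDensity c x) :
    Summable fun x => a x * logDensity c x := by
  refine h.abs.of_norm_bounded fun x => ?_
  rw [Real.norm_eq_abs, abs_mul, abs_mul, abs_of_nonneg (ha x),
    abs_of_nonneg ((ha x).trans (hac x))]
  exact mul_le_mul_of_nonneg_right (hac x) (abs_nonneg _)

lemma summable_info_of_le (ha : ∀ x, 0 ≤ a x) (hac : ∀ x, a x ≤ c x)
    (hc : Summable c) (h : Summable fun x => c x * logDensity c x) :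
    Summable fun x => a x * logDensity a x := by
  simpa using (summable_mul_logDensity_of_le ha hac h).sub
    (summable_mul_logDensity_sub ha hac (hc.of_nonneg_of_le ha hac) hc)

end Comparison

section Split

variable {a b c : ℕ × ℕ → ℝ}

lemma summable_info_add (ha : ∀ x, 0 ≤ a x) (hb : ∀ x, 0 ≤ b x) (hs : Summable a)
    (hb' : Summable b) (hc : ∀ x, c x = a x + b x)
    (h : Summable fun x => a x * logDensity a x) (h' : Summable fun x => b x * logDensity b x) :
    Summable fun x => c x * logDensity c x := by
  have hcs : Summable c := by simpa only [← hc] using hs.add hb'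
  have h1 := (summable_mul_logDensity_sub ha (fun x => by linarith [hc x, hb x]) hs hcs).add h
  have h2 := (summable_mul_logDensity_sub hb (fun x => by linarith [hc x, ha x]) hb' hcs).add h'
  refine (h1.add h2).congr fun x => ?_
  rw [hc]
  ring

/-- The homogeneous mutual information is additive up to the splitting entropy. -/
lemma abs_info_sub_add_le (ha : ∀ x, 0 ≤ a x) (hb : ∀ x, 0 ≤ b x) (hs : Summable c)
    (hc : ∀ x, c x = a x + b x) (h : Summable fun x => c x * logDensity c x) :
    |info c - (info a + info b)| ≤ splitEnt (∑' x, a x) (∑' x, b x) := by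
  have hac x : a x ≤ c x := by linarith [hc x, hb x]
  have hbc x : b x ≤ c x := by linarith [hc x, ha x]
  have has := hs.of_nonneg_of_le ha hac
  have hbs := hs.of_nonneg_of_le hb hbc
  have e : info c - (info a + info b) =
      ∑' x, (a x * logDensity c x - a x * logDensity a x) +
        ∑' x, (b x * logDensity c x - b x * logDensity b x) := by
    have ea := summable_mul_logDensity_of_le ha hac h
    have eb := summable_mul_logDensity_of_le hb hbc h
    rw [ea.tsum_sub (summable_info_of_le ha hac hs h),
      eb.tsum_sub (summable_info_of_le hb hbc hs h)]
    have : info c = ∑' x, a x * logDensity c x + ∑' x, b x * logDensity c x := by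
      rw [← ea.tsum_add eb, info]
      exact tsum_congr fun x => by rw [hc]; ring
    rw [this]
    unfold info
    ring
  have hC : ∑' x, c x = ∑' x, a x + ∑' x, b x := by
    rw [← has.tsum_add hbs]
    exact tsum_congr hc
  rw [e, splitEnt, ← hC]
  exact (abs_add_le _ _).trans (add_le_add (abs_tsum_mul_logDensity_sub_le ha hac has hs)
    (abs_tsum_mul_logDensity_sub_le hb hbc hbs hs))

/-- Gibbs' inequality: the homogeneous mutual information is nonnegative. -/
lemma info_nonneg (ha : ∀ x, 0 ≤ a x) (hs : Summable a)
    (h : Summable fun x => a x * logDensity a x) : 0 ≤ info a := by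
  set A := ∑' x, a x with hA
  have hA0 : 0 ≤ A := tsum_nonneg ha
  rcases hA0.eq_or_lt with h0 | hpos
  · have : ∀ x, a x = 0 := fun x => le_antisymm ((hs.le_tsum x fun _ _ => ha _).trans h0.ge) (ha x)
    simp [info, this]
  have hm : Summable fun x : ℕ × ℕ => row a x.1 * col a x.2 :=
    (summable_row hs).mul_of_nonneg (summable_col hs) (row_nonneg ha) (col_nonneg ha)
  have hm' : ∑' x : ℕ × ℕ, row a x.1 * col a x.2 = A * A := by
    rw [← (summable_row hs).tsum_mul_tsum (summable_col hs) hm, tsum_row hs, tsum_col hs]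
  have key := (hs.sub (hm.div_const A)).tsum_le_tsum (fun x => ?_) h
  · rw [hs.tsum_sub (hm.div_const A), tsum_div_const, hm', mul_div_cancel_right₀ _ hpos.ne',
      ← hA, sub_self] at key
    exact key
  · rcases (ha x).eq_or_lt with h | h
    · simp only [← h, zero_mul, zero_sub, neg_nonpos]
      exact div_nonneg (mul_nonneg (row_nonneg ha _) (col_nonneg ha _)) hA0
    have h1 : 0 < row a x.1 := h.trans_le (le_row ha hs x)
    have h3 : 0 < col a x.2 := h.trans_le (le_col ha hs x)
    have h2 := Real.one_sub_inv_le_log_of_pos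
      (show 0 < a x * A / (row a x.1 * col a x.2) by positivity)
    have h4 := mul_le_mul_of_nonneg_left h2 h.le
    have h5 : a x * (1 - (a x * A / (row a x.1 * col a x.2))⁻¹) =
        a x - row a x.1 * col a x.2 / A := by field_simp
    rw [h5] at h4
    exact h4

end Split

section SplitEnt

lemma splitEnt_comm (a b : ℝ) : splitEnt a b = splitEnt b a := by
  rw [splitEnt, splitEnt, add_comm a b, add_comm]

lemma splitEnt_mono_left {a a' b : ℝ} (ha : 0 ≤ a) (haa : a ≤ a') (hb : 0 ≤ b) :
    splitEnt a b ≤ splitEnt a' b := by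
  rcases hb.eq_or_lt with rfl | hb
  · simp [splitEnt]
  rcases ha.eq_or_lt with rfl | ha
  · have h : 0 ≤ splitEnt a' b := by
      rcases haa.eq_or_lt with rfl | h
      · simp [splitEnt, hb.ne']
      · exact add_nonneg
          (mul_nonneg h.le (Real.log_nonneg ((one_le_div h).2 (by linarith))))
          (mul_nonneg hb.le (Real.log_nonneg ((one_le_div hb).2 (by linarith))))
    simpa [splitEnt, hb.ne'] using h
  have ha' : 0 < a' := ha.trans_le haa
  have h1 : 0 ≤ Real.log ((a' + b) / a') := Real.log_nonneg ((one_le_div ha').2 (by linarith))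
  have h2 := Real.log_le_sub_one_of_pos
    (show 0 < ((a + b) / a) / ((a' + b) / a') by positivity)
  have h3 := Real.log_le_sub_one_of_pos
    (show 0 < ((a + b) / b) / ((a' + b) / b) by positivity)
  rw [Real.log_div (by positivity) (by positivity)] at h2 h3
  have h4 := mul_le_mul_of_nonneg_left h2 ha.le
  have h5 := mul_le_mul_of_nonneg_left h3 hb.le
  have h6 : a * ((a + b) / a / ((a' + b) / a') - 1) +
      b * ((a + b) / b / ((a' + b) / b) - 1) = 0 := by
    field_simp
    ring
  have h7 := mul_le_mul_of_nonneg_right haa h1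
  unfold splitEnt
  linarith

lemma splitEnt_one_left {x : ℝ} (hx : 0 ≤ x) : splitEnt 1 x = gFun x := by
  rcases hx.eq_or_lt with rfl | hx
  · simp [splitEnt, gFun]
  · rw [splitEnt, gFun, Real.log_div (by positivity) hx.ne', add_comm 1 x]
    simp
    ring

lemma splitEnt_one_sub (x : ℝ) : splitEnt (1 - x) x = binEnt x := by
  simp only [splitEnt, binEnt, Real.negMulLog, sub_add_cancel, one_div, Real.log_inv]
  ring

lemma gFun_mono {x y : ℝ} (hx : 0 ≤ x) (hxy : x ≤ y) : gFun x ≤ gFun y := by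
  rw [← splitEnt_one_left hx, ← splitEnt_one_left (hx.trans hxy), splitEnt_comm,
    splitEnt_comm 1]
  exact splitEnt_mono_left hx hxy zero_le_one

lemma binEnt_eq_binEntropy (x : ℝ) : binEnt x = Real.binEntropy x :=
  (Real.binEntropy_eq_negMulLog_add_negMulLog_one_sub x).symm

lemma binEnt_le_binEntTil {x y : ℝ} (hx : 0 ≤ x) (hxy : x ≤ y) : binEnt x ≤ binEntTil y := by
  unfold binEntTil
  simp only [binEnt_eq_binEntropy]
  split_ifs with h
  · exact Real.binEntropy_strictMonoOn.monotoneOn ⟨hx, by linarith⟩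
      ⟨hx.trans hxy, by linarith⟩ hxy
  · exact Real.binEntropy_le_log_two

end SplitEnt

section Translation

variable {a : ℕ × ℕ → ℝ}

lemma mutInfo_div_tsum (ha : ∀ x, 0 ≤ a x) (hs : Summable a) (hA : 0 < ∑' x, a x) :
    mutInfo (fun x => a x / ∑' y, a y) =
      if Summable (fun x => a x * logDensity a x) then
        ENNReal.ofReal (info a / ∑' x, a x) else ∞ := by
  set A := ∑' x, a x with hA'
  have hterm (x : ℕ × ℕ) : a x / A * Real.log (a x / A /
      ((∑' j, a (x.1, j) / A) * ∑' i, a (i, x.2) / A)) = a x * logDensity a x / A := by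
    have e : a x / A / ((∑' j, a (x.1, j) / A) * ∑' i, a (i, x.2) / A) =
        a x * A / (row a x.1 * col a x.2) := by
      rw [tsum_div_const, tsum_div_const]
      change a x / A / (row a x.1 / A * (col a x.2 / A)) = _
      rw [div_mul_div_comm, div_div_div_eq, ← mul_assoc, mul_comm A, mul_div_mul_right _ _ hA.ne']
    rw [e, logDensity, ← hA']
    ring
  have hsupp (x : ℕ × ℕ) (h : (∑' j, a (x.1, j) / A) * ∑' i, a (i, x.2) / A = 0) :
      a x / A = 0 := by
    rw [tsum_div_const, tsum_div_const] at h
    have hx : a x = 0 := by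
      refine le_antisymm ?_ (ha x)
      rcases mul_eq_zero.1 h with h | h
      · exact (le_row ha hs x).trans ((div_eq_zero_iff.1 h).resolve_right hA.ne').le
      · exact (le_col ha hs x).trans ((div_eq_zero_iff.1 h).resolve_right hA.ne').le
    rw [hx, zero_div]
  unfold mutInfo klDiv2
  rw [if_congr (and_iff_right hsupp) rfl rfl]
  simp only [hterm, summable_div_const_iff hA.ne']
  rw [tsum_div_const, ← info]

lemma mutInfo_eq (ha : ∀ x, 0 ≤ a x) (hs : Summable a) (h1 : ∑' x, a x = 1) :
    mutInfo a = if Summable (fun x => a x * logDensity a x) then ENNReal.ofReal (info a)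
      else ∞ := by
  simpa [h1] using mutInfo_div_tsum ha hs (by simp [h1])

lemma mutInfoExt_eq (ha : ∀ x, 0 ≤ a x) (hs : Summable a) (hA : 0 < ∑' x, a x)
    (h : Summable fun x => a x * logDensity a x) : mutInfoExt a = ENNReal.ofReal (info a) := by
  rw [mutInfoExt, mutInfo_div_tsum ha hs hA, if_pos h, ← ENNReal.ofReal_mul hA.le,
    mul_div_cancel₀ _ hA.ne']

end Translation

end MutInfoBound

/-- for a joint probability distribution `p̄` on `ℕ×ℕ` with
`I(X₁:X₂)_p̄ < +∞`, `ε ∈ (0,1]`, and any joint probability distribution `q̄` with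
`TV(p̄,q̄) ≤ ε`, one has
`I(X₁:X₂)_q̄ ≥ I(X₁:X₂)_p̄ − Ĩ(X₁:X₂)_{p̄∧ε} − 2g(ε) − h̃₂(ε)`, stated in
`[0,+∞]` as `I(X₁:X₂)_p̄ ≤ I(X₁:X₂)_q̄ + Ĩ(X₁:X₂)_{p̄∧ε} + 2g(ε) + h̃₂(ε)`. -/
theorem mutInfo_local_lower_bound_wedge (p q : ℕ × ℕ → ℝ)
    (hp0 : ∀ x, 0 ≤ p x) (hps : Summable p) (hp1 : ∑' x, p x = 1)
    (hpfin : mutInfo p ≠ ∞)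
    (hq0 : ∀ x, 0 ≤ q x) (hqs : Summable q) (hq1 : ∑' x, q x = 1)
    (ε : ℝ) (hε : ε ∈ Set.Ioc (0 : ℝ) 1)
    (hTV : (1 / 2) * ∑' x, |p x - q x| ≤ ε) :
    mutInfo p
      ≤ mutInfo q + mutInfoExt (fun x => min (p x) ε)
        + ENNReal.ofReal (2 * gFun ε) + ENNReal.ofReal (binEntTil ε) := by
  obtain ⟨hε0, hε1⟩ := hε
  have hp := MutInfoBound.mutInfo_eq hp0 hps hp1
  have hpS : Summable fun x => p x * MutInfoBound.logDensity p x := by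
    by_contra h
    exact hpfin (by rw [hp, if_neg h])
  rw [if_pos hpS] at hp
  have hq := MutInfoBound.mutInfo_eq hq0 hqs hq1
  by_cases hqS : Summable fun x => q x * MutInfoBound.logDensity q x
  swap
  · simp [hq, if_neg hqS]
  rw [if_pos hqS] at hq
  set t : ℕ × ℕ → ℝ := fun x => max (p x - q x) 0 with ht
  set s : ℕ × ℕ → ℝ := fun x => max (q x - p x) 0 with hs
  set a : ℕ × ℕ → ℝ := fun x => min (p x) ε with ha
  set ω : ℕ × ℕ → ℝ := fun x => max (p x) (q x) with hω
  have ht0 x : 0 ≤ t x := le_max_right _ _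
  have hs0 x : 0 ≤ s x := le_max_right _ _
  have ha0 x : 0 ≤ a x := le_min (hp0 x) hε0.le
  have hap x : a x ≤ p x := min_le_left _ _
  have htp x : t x ≤ p x := max_le (by linarith [hq0 x]) (hp0 x)
  have hsq x : s x ≤ q x := max_le (by linarith [hp0 x]) (hq0 x)
  have hωp x : ω x = p x + s x := by
    simp only [hω, hs]
    rw [← max_add_add_left, add_sub_cancel, add_zero, max_comm]
  have hωq x : ω x = q x + t x := by
    simp only [hω, ht]
    rw [← max_add_add_left, add_sub_cancel, add_zero]
  have has := hps.of_nonneg_of_le ha0 hap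
  have hts := hps.of_nonneg_of_le ht0 htp
  have hss := hqs.of_nonneg_of_le hs0 hsq
  set δ := ∑' x, t x with hδ
  have hst : ∑' x, s x = δ := by
    have h : ∑' x, (p x + s x) = ∑' x, (q x + t x) :=
      tsum_congr fun x => (hωp x).symm.trans (hωq x)
    rw [hps.tsum_add hss, hqs.tsum_add hts, hp1, hq1] at h
    linarith
  have hδ0 : 0 ≤ δ := tsum_nonneg ht0
  have hδε : δ ≤ ε := by
    have h : ∑' x, |p x - q x| = δ + δ := by
      nth_rewrite 2 [← hst]
      rw [hδ, ← hts.tsum_add hss]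
      refine tsum_congr fun x => ?_
      simp only [ht, hs]
      rcases le_total (p x) (q x) with h | h
      · rw [abs_of_nonpos (by linarith), max_eq_right (by linarith), max_eq_left (by linarith)]
        ring
      · rw [abs_of_nonneg (by linarith), max_eq_left (by linarith), max_eq_right (by linarith)]
        ring
    linarith
  have hta x : t x ≤ a x := le_min (htp x) ((hts.le_tsum x fun _ _ => ht0 _).trans hδε)
  have hA : 0 < ∑' x, a x := by
    refine (tsum_nonneg ha0).lt_of_ne fun h => ?_
    have hz x : p x = 0 := by
      have h1 : a x ≤ 0 := (has.le_tsum x fun _ _ => ha0 _).trans h.ge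
      rcases min_le_iff.1 h1 with h2 | h2
      · exact le_antisymm h2 (hp0 x)
      · linarith
    simp [hz] at hp1
  have haS := MutInfoBound.summable_info_of_le ha0 hap hps hpS
  have htS := MutInfoBound.summable_info_of_le ht0 htp hps hpS
  have hsS := MutInfoBound.summable_info_of_le hs0 hsq hqs hqS
  have hωS := MutInfoBound.summable_info_add hq0 ht0 hqs hts hωq hqS htS
  have hωs : Summable ω := (hqs.add hts).congr fun x => (hωq x).symm
  have hr0 x : 0 ≤ a x - t x := sub_nonneg.2 (hta x)
  have h1 := (abs_le.1 (MutInfoBound.abs_info_sub_add_le hp0 hs0 hωs hωp hωS)).1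
  have h2 := (abs_le.1 (MutInfoBound.abs_info_sub_add_le hq0 ht0 hωs hωq hωS)).2
  have h3 := (abs_le.1 (MutInfoBound.abs_info_sub_add_le hr0 ht0 has
    (fun x => (sub_add_cancel _ _).symm) haS)).1
  rw [hp1, hst, MutInfoBound.splitEnt_one_left hδ0] at h1
  rw [hq1, ← hδ, MutInfoBound.splitEnt_one_left hδ0] at h2
  rw [has.tsum_sub hts, ← hδ] at h3
  have hr := MutInfoBound.info_nonneg hr0 (has.sub hts) (MutInfoBound.summable_info_of_le hr0
    (fun x => sub_le_self _ (ht0 x)) has haS)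
  have hs' := MutInfoBound.info_nonneg hs0 hss hsS
  have hA1 : ∑' x, a x ≤ 1 := hp1 ▸ has.tsum_le_tsum hap hps
  have h4 := MutInfoBound.splitEnt_mono_left (sub_nonneg.2 (hts.tsum_le_tsum hta has))
    (sub_le_sub_right hA1 δ) hδ0
  rw [MutInfoBound.splitEnt_one_sub] at h4
  have h5 := MutInfoBound.binEnt_le_binEntTil hδ0 hδε
  have h6 := MutInfoBound.gFun_mono hδ0 hδε
  rw [hp, hq, MutInfoBound.mutInfoExt_eq ha0 has hA haS]
  calc ENNReal.ofReal (MutInfoBound.info p)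
      ≤ ENNReal.ofReal (MutInfoBound.info q + MutInfoBound.info a + 2 * gFun ε +
          binEntTil ε) := ENNReal.ofReal_le_ofReal (by linarith)
    _ ≤ _ := ENNReal.ofReal_add_le.trans (add_le_add_left (ENNReal.ofReal_add_le.trans
        (add_le_add_left ENNReal.ofReal_add_le _)) _)
end
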